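/- arXiv:2101.03482 — 2 statements merged into one kernel-verified Lean document; each statement's English description precedes it below -/
import Mathlib

section
/- Let R be a principal ideal domain, ≻ a monomial ordering, and F = {f_1,…,f_s} ⊂ R[x_1,…,x_n] \ R nonconstant polynomials all having the same leading monomial lm(f_j) = x^α. (i) If f = Σ_{j=1}^s f_j satisfies lm(f) ≺ x^α (in particular if f = 0), then there exist nonzero multipliers b, b_1,…,b_{s-1} ∈ R such that b·f = Σ_{1≤j<s} b_j·S(f_j, f_s). (ii) Moreover, for any prime element p of R, after a permutation of the indices choosing f_s so that the multiplicity of p in lc(f_s) is minimal among the multiplicities of p in the lc(f_j), the multiplier b in (i) can be chosen not divisible by p. -/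
open MvPolynomial

/-- A monomial ordering on the monomials (exponent vectors) in `m` variables:
a well-ordering compatible with addition of exponents. -/
structure MonomialOrdering (m : ℕ) where
  lin : LinearOrder (Fin m →₀ ℕ)
  wf : WellFounded lin.lt
  add_lt_add : ∀ a b c : Fin m →₀ ℕ, lin.lt a b → lin.lt (a + c) (b + c)

variable {m : ℕ}

open Classical in
/-- Leading monomial of `f` (junk value `0` for `f = 0`). -/
noncomputable def lmon {R : Type*} [CommRing R] (mo : MonomialOrdering m)
    (f : MvPolynomial (Fin m) R) : Fin m →₀ ℕ :=
  letI := mo.lin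
  if h : f = 0 then 0
  else f.support.max' (Finset.nonempty_iff_ne_empty.mpr
    (fun he => h (MvPolynomial.support_eq_empty.mp he)))

/-- Leading coefficient of `f`. -/
noncomputable def lcoeff {R : Type*} [CommRing R] (mo : MonomialOrdering m)
    (f : MvPolynomial (Fin m) R) : R :=
  f.coeff (lmon mo f)

/-- Leading term of `f`, as a polynomial. -/
noncomputable def lterm {R : Type*} [CommRing R] (mo : MonomialOrdering m)
    (f : MvPolynomial (Fin m) R) : MvPolynomial (Fin m) R :=
  MvPolynomial.monomial (lmon mo f) (lcoeff mo f)

/-- `f` is a nonconstant polynomial, i.e. `f ∉ R`. -/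
def Nonconst {R : Type*} [CommRing R] (f : MvPolynomial (Fin m) R) : Prop :=
  ∀ c : R, f ≠ MvPolynomial.C c

/-- A nonzero polynomial has nonzero leading coefficient. -/
lemma lcoeff_ne_zero {R : Type*} [CommRing R] (mo : MonomialOrdering m)
    {f : MvPolynomial (Fin m) R} (hf : f ≠ 0) : lcoeff mo f ≠ 0 := by
  classical
  refine mem_support_iff.mp ?_
  simp only [lmon, dif_neg hf]
  exact @Finset.max'_mem _ mo.lin _ _

/-- A monomial above the leading monomial has zero coefficient. -/
lemma coeff_eq_zero_of_lmon_lt {R : Type*} [CommRing R] (mo : MonomialOrdering m)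
    {f : MvPolynomial (Fin m) R} {α : Fin m →₀ ℕ}
    (h : f ≠ 0 → mo.lin.lt (lmon mo f) α) : f.coeff α = 0 := by
  classical
  by_contra hα
  have hf : f ≠ 0 := by
    rintro rfl
    exact hα (coeff_zero α)
  have hlt := h hf
  simp only [lmon, dif_neg hf] at hlt
  have hle := @Finset.le_max' _ mo.lin _ _ (mem_support_iff.mpr hα)
  exact (@not_lt_of_ge _ mo.lin.toPreorder _ _ hle) hlt

/-- If `a * μ` is a least common multiple of `a` and `d`, and the multiplicity of the prime `p`
in `d` is at most that in `a`, then `p` does not divide the cofactor `μ`. -/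
lemma Prime.not_dvd_lcm_cofactor {R : Type*} [CommRing R] [IsDomain R] [WfDvdMonoid R]
    {p a d μ : R} (hp : Prime p) (ha : a ≠ 0) (hd : d ≠ 0) (hμ : μ ≠ 0) (hdvd : d ∣ a * μ)
    (hlcm : ∀ e, a ∣ e → d ∣ e → a * μ ∣ e) (hmul : ∀ k : ℕ, p ^ k ∣ d → p ^ k ∣ a) :
    ¬ p ∣ μ := by
  rintro ⟨u, rfl⟩
  obtain ⟨k, d', hd', rfl⟩ := WfDvdMonoid.max_power_factor hd hp.irreducible
  obtain ⟨c, rfl⟩ := hmul k (dvd_mul_right _ _)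
  have hpk : p ^ k ≠ 0 := pow_ne_zero k hp.ne_zero
  obtain ⟨t, ht⟩ := hdvd
  have ht' : p * (c * u) = d' * t :=
    mul_left_cancel₀ hpk (by linear_combination ht)
  obtain ⟨v, rfl⟩ := (hp.dvd_or_dvd ⟨c * u, ht'.symm⟩).resolve_left hd'
  have hcu : c * u = d' * v := mul_left_cancel₀ hp.ne_zero (by linear_combination ht')
  obtain ⟨w, hw⟩ := hlcm (p ^ k * c * u) (dvd_mul_right _ _)
    ⟨v, by linear_combination p ^ k * hcu⟩
  have hne : p ^ k * c * u ≠ 0 := mul_ne_zero ha (right_ne_zero_of_mul hμ)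
  exact hp.not_isUnit (.of_mul_eq_one w (mul_left_cancel₀ hne (by linear_combination -hw)))

/-- If `∑ j, a j = 0`, then `∏ i, μ i` is a common multiplier expressing the sum of the `f j`
through the combinations `μ j * f j - ν j * f s`, where `a j * μ j = a s * ν j`. -/
lemma prod_mul_sum_eq_sum_erase {R A : Type*} [CommRing R] [IsDomain R] [CommRing A]
    (φ : R →+* A) {s : ℕ} (f : Fin (s + 1) → A) (a : Fin (s + 1) → R) (μ ν : Fin s → R)
    (ha : a (Fin.last s) ≠ 0) (hsum : ∑ j, a j = 0)
    (h : ∀ j : Fin s, a j.castSucc * μ j = a (Fin.last s) * ν j) :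
    φ (∏ i, μ i) * ∑ j, f j = ∑ j : Fin s, φ (∏ i ∈ Finset.univ.erase j, μ i) *
      (φ (μ j) * f j.castSucc - φ (ν j) * f (Fin.last s)) := by
  have hprod (j : Fin s) : (∏ i ∈ Finset.univ.erase j, μ i) * μ j = ∏ i, μ i :=
    Finset.prod_erase_mul _ _ (Finset.mem_univ j)
  have hν : ∑ j, (∏ i ∈ Finset.univ.erase j, μ i) * ν j = -∏ i, μ i := by
    apply mul_left_cancel₀ ha
    have key : a (Fin.last s) * ∑ j, (∏ i ∈ Finset.univ.erase j, μ i) * ν j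
        = (∏ i, μ i) * ∑ j : Fin s, a j.castSucc := by
      rw [Finset.mul_sum, Finset.mul_sum]
      refine Finset.sum_congr rfl fun j _ => ?_
      rw [← hprod j]
      linear_combination -(∏ i ∈ Finset.univ.erase j, μ i) * h j
    rw [Fin.sum_univ_castSucc] at hsum
    linear_combination key + (∏ i, μ i) * hsum
  have hφ : ∑ j, φ (∏ i ∈ Finset.univ.erase j, μ i) * φ (ν j) = -φ (∏ i, μ i) := by
    rw [← map_neg, ← hν, map_sum]
    simp only [map_mul]
  simp only [mul_sub, ← mul_assoc, Finset.sum_sub_distrib]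
  rw [← Finset.sum_mul, hφ, Fin.sum_univ_castSucc, mul_add, Finset.mul_sum]
  simp only [← map_mul, hprod]
  ring

/-- Syzygy lemma over a PID: if `f_0, …, f_s` are nonconstant polynomials with the same
leading monomial `x^α` and `lm(Σ f_j) ≺ x^α` (in particular if the sum is zero), then
`b·(Σ f_j) = Σ_{j<s} b_j·S(f_j, f_s)` for some nonzero multipliers `b, b_j ∈ R`;
moreover, for a prime `p` such that (after relabelling) the multiplicity of `p` in
`lc(f_s)` is minimal, the multiplier `b` can be chosen not divisible by `p`. -/
theorem syzygy_spoly_expansion {R : Type*} [CommRing R] [IsDomain R]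
    [IsPrincipalIdealRing R] (mo : MonomialOrdering m)
    (s : ℕ) (f : Fin (s + 1) → MvPolynomial (Fin m) R)
    (hfnc : ∀ j, Nonconst (f j))
    (α : Fin m →₀ ℕ) (hlm : ∀ j, lmon mo (f j) = α)
    -- lcm data for the pairs `(lc (f j), lc (f s))`
    (mm μ ν : Fin s → R)
    (hμ : ∀ j : Fin s, lcoeff mo (f j.castSucc) * μ j = mm j)
    (hν : ∀ j : Fin s, lcoeff mo (f (Fin.last s)) * ν j = mm j)
    (hlcm : ∀ (j : Fin s) (e : R),
      lcoeff mo (f j.castSucc) ∣ e → lcoeff mo (f (Fin.last s)) ∣ e → mm j ∣ e)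
    (hsum : (∑ j, f j) ≠ 0 → mo.lin.lt (lmon mo (∑ j, f j)) α) :
    (∃ (b : R) (bj : Fin s → R),
      b ≠ 0 ∧ (∀ j, bj j ≠ 0) ∧
      MvPolynomial.C b * (∑ j, f j)
        = ∑ j : Fin s, MvPolynomial.C (bj j) *
            (MvPolynomial.C (μ j) * f j.castSucc -
              MvPolynomial.C (ν j) * f (Fin.last s))) ∧
    (∀ p : R, Prime p →
      (∀ (j : Fin (s + 1)) (k : ℕ),
        p ^ k ∣ lcoeff mo (f (Fin.last s)) → p ^ k ∣ lcoeff mo (f j)) →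
      ∃ (b : R) (bj : Fin s → R),
        b ≠ 0 ∧ (∀ j, bj j ≠ 0) ∧ ¬ p ∣ b ∧
        MvPolynomial.C b * (∑ j, f j)
          = ∑ j : Fin s, MvPolynomial.C (bj j) *
              (MvPolynomial.C (μ j) * f j.castSucc -
                MvPolynomial.C (ν j) * f (Fin.last s))) := by
  have hf0 (j) : f j ≠ 0 := fun h => hfnc j 0 (by rw [h, C_0])
  have ha (j) : lcoeff mo (f j) ≠ 0 := lcoeff_ne_zero mo (hf0 j)
  have hasum : ∑ j, lcoeff mo (f j) = 0 := by
    simpa only [_root_.lcoeff, hlm, coeff_sum] using coeff_eq_zero_of_lmon_lt mo hsum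
  have hμ0 (j) : μ j ≠ 0 := by
    intro h0
    have hdvd := hlcm j _ (dvd_mul_right _ (lcoeff mo (f (Fin.last s)))) (dvd_mul_left _ _)
    rw [← hμ, h0, mul_zero, zero_dvd_iff] at hdvd
    exact mul_ne_zero (ha _) (ha _) hdvd
  have hb : ∏ i, μ i ≠ 0 := Finset.prod_ne_zero_iff.mpr fun i _ => hμ0 i
  have hbj (j : Fin s) : ∏ i ∈ Finset.univ.erase j, μ i ≠ 0 :=
    Finset.prod_ne_zero_iff.mpr fun i _ => hμ0 i
  have hexp := prod_mul_sum_eq_sum_erase C f (fun j => lcoeff mo (f j)) μ ν (ha _) hasum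
    fun j => (hμ j).trans (hν j).symm
  refine ⟨⟨_, _, hb, hbj, hexp⟩, fun p hp hmin => ⟨_, _, hb, hbj, fun hdvd => ?_, hexp⟩⟩
  obtain ⟨j, -, hj⟩ := hp.exists_mem_finset_dvd hdvd
  refine hp.not_dvd_lcm_cofactor (ha j.castSucc) (ha (Fin.last s)) (hμ0 j)
    ⟨ν j, (hμ j).trans (hν j).symm⟩ (fun e => ?_) (hmin _) hj
  rw [hμ]
  exact hlcm j e
end

section
/- Let K be a field, q ∈ K[x_1] nonconstant, R̄ = K[x_1]/⟨q⟩, fix a monomial ordering on the x̃-monomials, and let B = {g_1,…,g_s} ⊂ R̄[x̃] \ R̄ be a finite set of nonconstant polynomials. For every f ∈ R̄[x̃] there exist a unit λ ∈ R̄^×, quotients h_1,…,h_s ∈ R̄[x̃] and a remainder r ∈ R̄[x̃] such that λ·f = Σ_{j=1}^s h_j·g_j + r, the remainder r is gcd-reduced with respect to B, and lm(f) = max{max_j lm(h_j)·lm(g_j), lm(r)}, the maximum being over the nonzero h_j and nonzero r. -/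
open MvPolynomial

variable {m : ℕ}

/-- `r` is gcd-reduced with respect to `B`: no nonzero term `c·x̃^α` of `r` is
gcd-reducible with respect to `B`, i.e. for no `α` in the support of `r` does some `lm b`
(`b ∈ B`) divide `x̃^α` with `r.coeff α` in the ideal generated by the leading coefficients
of those `b ∈ B` whose leading monomial divides `x̃^α`. -/
def GcdReduced {R : Type*} [CommRing R] (mo : MonomialOrdering m)
    (B : Finset (MvPolynomial (Fin m) R)) (r : MvPolynomial (Fin m) R) : Prop :=
  ∀ α ∈ r.support, ¬ ((∃ b ∈ B, ∃ δ, α = lmon mo b + δ) ∧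
    r.coeff α ∈ Ideal.span {c : R | ∃ b ∈ B, (∃ δ, α = lmon mo b + δ) ∧ c = lcoeff mo b})

section Division

variable {R : Type*} [CommRing R] (mo : MonomialOrdering m)

namespace MonomialOrdering

theorem lt_of_le_of_ne {a b : Fin m →₀ ℕ} (h : mo.lin.le a b) (hne : a ≠ b) : mo.lin.lt a b :=
  @_root_.lt_of_le_of_ne _ mo.lin.toPartialOrder _ _ h hne

theorem le_of_lt {a b : Fin m →₀ ℕ} (h : mo.lin.lt a b) : mo.lin.le a b :=
  @_root_.le_of_lt _ mo.lin.toPreorder _ _ h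

theorem ne_of_lt {a b : Fin m →₀ ℕ} (h : mo.lin.lt a b) : a ≠ b :=
  @_root_.ne_of_lt _ mo.lin.toPreorder _ _ h

theorem lt_of_le_of_lt {a b c : Fin m →₀ ℕ} (h : mo.lin.le a b) (h' : mo.lin.lt b c) :
    mo.lin.lt a c :=
  @_root_.lt_of_le_of_lt _ mo.lin.toPreorder _ _ _ h h'

theorem add_le_add_left {a b : Fin m →₀ ℕ} (h : mo.lin.le a b) (c : Fin m →₀ ℕ) :
    mo.lin.le (c + a) (c + b) := by
  rcases eq_or_ne a b with rfl | hne
  · exact mo.lin.le_refl _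
  · rw [add_comm c a, add_comm c b]
    exact mo.le_of_lt (mo.add_lt_add a b c (mo.lt_of_le_of_ne h hne))

end MonomialOrdering

theorem le_lmon {p : MvPolynomial (Fin m) R} {β : Fin m →₀ ℕ} (hβ : β ∈ p.support) :
    mo.lin.le β (lmon mo p) := by
  have hp : p ≠ 0 := by
    rintro rfl
    simp at hβ
  simp only [lmon, dif_neg hp]
  exact @Finset.le_max' _ mo.lin _ _ hβ

theorem lmon_mem_support {p : MvPolynomial (Fin m) R} (hp : p ≠ 0) : lmon mo p ∈ p.support := by
  simp only [lmon, dif_neg hp]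
  exact @Finset.max'_mem _ mo.lin _ _

/-- Every exponent of a product `p * b` is bounded by `β + lmon b` for some exponent `β` of `p`. -/
theorem exists_le_add_lmon {p b : MvPolynomial (Fin m) R} {γ : Fin m →₀ ℕ}
    (hγ : γ ∈ (p * b).support) :
    ∃ β ∈ p.support, mo.lin.le γ (β + lmon mo b) := by
  classical
  obtain ⟨β, hβ, δ, hδ, rfl⟩ := Finset.mem_add.mp (MvPolynomial.support_mul p b hγ)
  exact ⟨β, hβ, mo.add_le_add_left (le_lmon mo hδ) β⟩

/-- A reducible coefficient at `α` is the coefficient at `α` of a combination of `B` whose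
quotients are single terms. -/
theorem exists_quotients_of_mem_span (B : Finset (MvPolynomial (Fin m) R)) (α : Fin m →₀ ℕ) {c : R}
    (hc : c ∈ Ideal.span {c : R | ∃ b ∈ B, (∃ δ, α = lmon mo b + δ) ∧ c = lcoeff mo b}) :
    ∃ h : MvPolynomial (Fin m) R → MvPolynomial (Fin m) R,
      (∀ b ∈ B, ∀ β ∈ (h b).support, β + lmon mo b = α) ∧
      (∑ b ∈ B, h b * b).coeff α = c := by
  classical
  induction hc using Submodule.span_induction with
  | mem x hx =>
    obtain ⟨b, hb, ⟨δ, rfl⟩, rfl⟩ := hx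
    refine ⟨Pi.single b (monomial δ 1), fun b' _ β hβ => ?_, ?_⟩
    · rcases eq_or_ne b' b with rfl | hne
      · rw [Pi.single_eq_same] at hβ
        rw [Finset.mem_singleton.mp (support_monomial_subset hβ), add_comm]
      · simp [Pi.single_eq_of_ne hne] at hβ
    · rw [Finset.sum_eq_single_of_mem b hb fun b' _ hne => by simp [Pi.single_eq_of_ne hne],
        Pi.single_eq_same, add_comm, coeff_monomial_mul, one_mul, _root_.lcoeff]
  | zero => exact ⟨0, by simp, by simp⟩
  | add x y _ _ hx hy =>
    obtain ⟨h, hh, rfl⟩ := hx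
    obtain ⟨k, hk, rfl⟩ := hy
    refine ⟨h + k, fun b hb β hβ => ?_, ?_⟩
    · rcases Finset.mem_union.mp (support_add hβ) with hβ | hβ
      exacts [hh b hb β hβ, hk b hb β hβ]
    · simp [add_mul, Finset.sum_add_distrib]
  | smul a x _ hx =>
    obtain ⟨h, hh, rfl⟩ := hx
    refine ⟨fun b => C a * h b, fun b hb β hβ => hh b hb β ?_, ?_⟩
    · rw [mem_support_iff, coeff_C_mul] at hβ
      exact mem_support_iff.mpr (right_ne_zero_of_mul hβ)
    · simp_rw [mul_assoc, ← Finset.mul_sum, coeff_C_mul, smul_eq_mul]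

/-- Adding a term above all exponents of a reduced polynomial keeps it reduced, provided the new
term is irreducible. -/
theorem GcdReduced.add_monomial {B : Finset (MvPolynomial (Fin m) R)}
    {r : MvPolynomial (Fin m) R} (hr : GcdReduced mo B r) {α : Fin m →₀ ℕ} {c : R}
    (hα : r.coeff α = 0)
    (hc : c ≠ 0 → ¬ ((∃ b ∈ B, ∃ δ, α = lmon mo b + δ) ∧
      c ∈ Ideal.span {c : R | ∃ b ∈ B, (∃ δ, α = lmon mo b + δ) ∧ c = lcoeff mo b})) :
    GcdReduced mo B (r + monomial α c) := by
  intro β hβ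
  rcases eq_or_ne α β with rfl | hne
  · have hcoeff : (r + monomial α c).coeff α = c := by simp [hα]
    rw [mem_support_iff] at hβ
    rw [hcoeff] at hβ ⊢
    exact hc hβ
  · have hcoeff : (r + monomial α c).coeff β = r.coeff β := by simp [coeff_monomial, hne]
    rw [mem_support_iff] at hβ
    rw [hcoeff] at hβ ⊢
    exact hr β (mem_support_iff.mpr hβ)

/-- Cancelling the coefficient at `α`, either by a combination of `B` or by an irreducible term. -/
theorem exists_leading_step (B : Finset (MvPolynomial (Fin m) R)) (α : Fin m →₀ ℕ) (c : R) :
    ∃ (h : MvPolynomial (Fin m) R → MvPolynomial (Fin m) R) (d : R),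
      (∀ b ∈ B, ∀ β ∈ (h b).support, β + lmon mo b = α) ∧
      (∑ b ∈ B, h b * b).coeff α + d = c ∧
      (d ≠ 0 → ¬ ((∃ b ∈ B, ∃ δ, α = lmon mo b + δ) ∧
        d ∈ Ideal.span {c : R | ∃ b ∈ B, (∃ δ, α = lmon mo b + δ) ∧ c = lcoeff mo b})) := by
  by_cases hc : c ∈ Ideal.span {c : R | ∃ b ∈ B, (∃ δ, α = lmon mo b + δ) ∧ c = lcoeff mo b}
  · obtain ⟨h, hh, hsum⟩ := exists_quotients_of_mem_span mo B α hc
    exact ⟨h, 0, hh, by rw [hsum, add_zero], fun h0 => absurd rfl h0⟩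
  · exact ⟨0, c, by simp, by simp, fun _ hred => hc hred.2⟩

/-- Multivariate division over an arbitrary commutative ring, for polynomials with exponents
bounded by `α`. -/
theorem exists_gcdReduced_remainder (B : Finset (MvPolynomial (Fin m) R)) (α : Fin m →₀ ℕ) :
    ∀ f : MvPolynomial (Fin m) R, (∀ β ∈ f.support, mo.lin.le β α) →
    ∃ (h : MvPolynomial (Fin m) R → MvPolynomial (Fin m) R) (r : MvPolynomial (Fin m) R),
      f = (∑ b ∈ B, h b * b) + r ∧ GcdReduced mo B r ∧
      (∀ b ∈ B, ∀ β ∈ (h b).support, mo.lin.le (β + lmon mo b) α) ∧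
      ∀ β ∈ r.support, mo.lin.le β α := by
  classical
  induction α using mo.wf.induction with
  | h α ih =>
  intro f hf
  obtain ⟨h₀, d, hh₀, hd, hirr⟩ := exists_leading_step mo B α (f.coeff α)
  set g := f - ∑ b ∈ B, h₀ b * b - monomial α d with hg
  have hglt : ∀ β ∈ g.support, mo.lin.lt β α := by
    intro β hβ
    refine mo.lt_of_le_of_ne ?_ ?_
    · rcases Finset.mem_union.mp (support_sub _ _ _ hβ) with hβ | hβ
      · rcases Finset.mem_union.mp (support_sub _ _ _ hβ) with hβ | hβ
        · exact hf β hβ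
        · obtain ⟨b, hb, hβ⟩ := Finset.mem_biUnion.mp (support_sum hβ)
          obtain ⟨γ, hγ, hle⟩ := exists_le_add_lmon mo hβ
          rwa [hh₀ b hb γ hγ] at hle
      · rw [Finset.mem_singleton.mp (support_monomial_subset hβ)]
        exact mo.lin.le_refl _
    · rintro rfl
      refine mem_support_iff.mp hβ ?_
      rw [hg, coeff_sub, coeff_sub, coeff_monomial, if_pos rfl, ← hd]
      ring
  obtain ⟨h₁, r₁, hdiv, hred, hh₁, hr₁⟩ :
      ∃ (h : MvPolynomial (Fin m) R → MvPolynomial (Fin m) R) (r : MvPolynomial (Fin m) R),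
        g = (∑ b ∈ B, h b * b) + r ∧ GcdReduced mo B r ∧
        (∀ b ∈ B, ∀ β ∈ (h b).support, mo.lin.lt (β + lmon mo b) α) ∧
        ∀ β ∈ r.support, mo.lin.lt β α := by
    rcases eq_or_ne g 0 with h0 | h0
    · exact ⟨0, 0, by simp [h0], by simp [GcdReduced], by simp, by simp⟩
    · have hlt := hglt _ (lmon_mem_support mo h0)
      obtain ⟨h, r, hdiv, hred, hh, hr⟩ := ih _ hlt g fun β hβ => le_lmon mo hβ
      exact ⟨h, r, hdiv, hred, fun b hb β hβ => mo.lt_of_le_of_lt (hh b hb β hβ) hlt,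
        fun β hβ => mo.lt_of_le_of_lt (hr β hβ) hlt⟩
  refine ⟨h₀ + h₁, r₁ + monomial α d, ?_, hred.add_monomial mo ?_ hirr, fun b hb β hβ => ?_,
    fun β hβ => ?_⟩
  · simp only [Pi.add_apply, add_mul, Finset.sum_add_distrib]
    linear_combination hdiv
  · by_contra hne
    exact mo.ne_of_lt (hr₁ α (mem_support_iff.mpr hne)) rfl
  · rcases Finset.mem_union.mp (support_add hβ) with hβ | hβ
    · rw [hh₀ b hb β hβ]
      exact mo.lin.le_refl _
    · exact mo.le_of_lt (hh₁ b hb β hβ)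
  · rcases Finset.mem_union.mp (support_add hβ) with hβ | hβ
    · exact mo.le_of_lt (hr₁ β hβ)
    · rw [Finset.mem_singleton.mp (support_monomial_subset hβ)]
      exact mo.lin.le_refl _

end Division

/-- gcd-division over `R̄ = K[x₁]/⟨q⟩`: for a finite set `B` of nonconstant polynomials and
any `f`, there are a unit multiplier `λ`, quotients and a gcd-reduced remainder with
`λ·f = Σ h_j·g_j + r` and `lm f = max{max_j lm(h_j)·lm(g_j), lm r}` over the nonzero `h_j`
and nonzero `r`. -/
theorem gcd_division {K : Type*} [Field K]
    (q : Polynomial K) (hq : 0 < q.natDegree)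
    (mo : MonomialOrdering m)
    (B : Finset (MvPolynomial (Fin m) (Polynomial K ⧸ Ideal.span {q})))
    (hBne : B.Nonempty) (hBnc : ∀ b ∈ B, Nonconst b)
    (f : MvPolynomial (Fin m) (Polynomial K ⧸ Ideal.span {q})) :
    ∃ (lam : Polynomial K ⧸ Ideal.span {q})
      (h : MvPolynomial (Fin m) (Polynomial K ⧸ Ideal.span {q}) →
        MvPolynomial (Fin m) (Polynomial K ⧸ Ideal.span {q}))
      (r : MvPolynomial (Fin m) (Polynomial K ⧸ Ideal.span {q})),
      IsUnit lam ∧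
      MvPolynomial.C lam * f = (∑ b ∈ B, h b * b) + r ∧
      GcdReduced mo B r ∧
      (∀ b ∈ B, h b ≠ 0 → mo.lin.le (lmon mo (h b) + lmon mo b) (lmon mo f)) ∧
      (r ≠ 0 → mo.lin.le (lmon mo r) (lmon mo f)) ∧
      (f ≠ 0 → (r ≠ 0 ∧ lmon mo r = lmon mo f) ∨
        ∃ b ∈ B, h b ≠ 0 ∧ lmon mo (h b) + lmon mo b = lmon mo f) := by
  classical
  obtain ⟨h, r, hdiv, hred, hh, hr⟩ :=
    exists_gcdReduced_remainder mo B (lmon mo f) f fun β hβ => le_lmon mo hβ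
  have hle : ∀ b ∈ B, h b ≠ 0 → mo.lin.le (lmon mo (h b) + lmon mo b) (lmon mo f) :=
    fun b hb h0 => hh b hb _ (lmon_mem_support mo h0)
  refine ⟨1, h, r, isUnit_one, by rw [C_1, one_mul, ← hdiv], hred, hle,
    fun h0 => hr _ (lmon_mem_support mo h0), fun hf => ?_⟩
  have hmem := lmon_mem_support mo hf
  have hmem' : lmon mo f ∈ ((∑ b ∈ B, h b * b) + r).support := hdiv ▸ hmem
  rcases Finset.mem_union.mp (support_add hmem') with hs | hs
  · obtain ⟨b, hb, hs⟩ := Finset.mem_biUnion.mp (support_sum hs)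
    obtain ⟨β, hβ, hβle⟩ := exists_le_add_lmon mo hs
    have h0 : h b ≠ 0 := by
      intro h0
      simp [h0] at hβ
    refine Or.inr ⟨b, hb, h0, mo.lin.le_antisymm _ _ (hle b hb h0) ?_⟩
    refine mo.lin.le_trans _ _ _ hβle ?_
    rw [add_comm β, add_comm (lmon mo (h b))]
    exact mo.add_le_add_left (le_lmon mo hβ) _
  · have h0 : r ≠ 0 := by
      rintro rfl
      simp at hs
    exact Or.inl ⟨h0, mo.lin.le_antisymm _ _ (hr _ (lmon_mem_support mo h0)) (le_lmon mo hs)⟩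
end
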